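/- arXiv:math/0612061 — 3 statements merged into one kernel-verified Lean document; each statement's English description precedes it below -/
import Mathlib

section
/- Let n be an even positive integer. The set of extreme points of the convex hull in ℝ^{n−1} of all realizable dual degree partitions on n vertices is exactly {a^(k) : k = 0, 1, …, n−1}, where a^(k) = (n, …, n, 0, …, 0) with k entries equal to n followed by n−1−k zeros. -/
/-- The degree of a vertex `v` in a simple graph `G` on `Fin n`. -/
noncomputable def deg {n : ℕ} (G : SimpleGraph (Fin n)) (v : Fin n) : ℕ :=
  Set.ncard {w | G.Adj v w}

/-- The dual degree partition of a graph `G` on `n` vertices, regarded as a point of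
`ℝ^{n-1}`: the `j`-th coordinate (0-indexed) is `d*_{j+1} = #{v : deg v ≥ j+1}`. -/
noncomputable def ddp (n : ℕ) (G : SimpleGraph (Fin n)) : Fin (n - 1) → ℝ :=
  fun j => (Set.ncard {v : Fin n | (j : ℕ) + 1 ≤ deg G v} : ℝ)

/-- `x ∈ ℝ^{n-1}` is a realizable dual degree partition on `n` vertices. -/
def IsRealizableDDP (n : ℕ) (x : Fin (n - 1) → ℝ) : Prop :=
  ∃ G : SimpleGraph (Fin n), x = ddp n G

/-- The point `a^(k) = (n,…,n,0,…,0)` with `k` entries `n` followed by `n-1-k` zeros. -/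
noncomputable def aPoint (n k : ℕ) : Fin (n - 1) → ℝ :=
  fun j => if (j : ℕ) < k then (n : ℝ) else 0

/-- The point `b^(k,l)`: `2k` entries `n`, then `2l+1` entries `n-1`, then zeros. -/
noncomputable def bPoint (n k l : ℕ) : Fin (n - 1) → ℝ :=
  fun j => if (j : ℕ) < 2 * k then (n : ℝ)
           else if (j : ℕ) < 2 * k + 2 * l + 1 then (n : ℝ) - 1 else 0

/-- The point `c^(k,l)`: `2k+1` entries `n`, then `2l+1` entries `1`, then zeros. -/
noncomputable def cPoint (n k l : ℕ) : Fin (n - 1) → ℝ :=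
  fun j => if (j : ℕ) < 2 * k + 1 then (n : ℝ)
           else if (j : ℕ) < 2 * k + 2 * l + 2 then 1 else 0

/-- The polytope `{x ∈ ℝ^{n-1} : n ≥ x_1 ≥ x_2 ≥ ⋯ ≥ x_{n-1} ≥ 0}`. -/
def Rpoly (n : ℕ) : Set (Fin (n - 1) → ℝ) :=
  {x | (∀ i, x i ≤ n) ∧ (∀ i, 0 ≤ x i) ∧ ∀ i j : Fin (n - 1), i ≤ j → x j ≤ x i}

/-- The alternating sum `(x_1 - x_2) + (x_3 - x_4) + ⋯ + (x_{n-2} - x_{n-1})`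
(for odd `n`; in 0-indexed form the pairs are `(0,1), (2,3), …, (n-3,n-2)`). -/
noncomputable def altSum (n : ℕ) (x : Fin (n - 1) → ℝ) : ℝ :=
  ∑ i ∈ Finset.range ((n - 1) / 2),
    ((if h : 2 * i < n - 1 then x ⟨2 * i, h⟩ else 0) -
     (if h : 2 * i + 1 < n - 1 then x ⟨2 * i + 1, h⟩ else 0))

theorem exists_symm_set (n : ℕ) [NeZero n] (h : Fin n) (hh : 2 * h.val = n) :
    ∀ j : ℕ, 2 * j + 2 ≤ n → ∃ S : Finset (Fin n), S.card = 2 * j ∧ (0 : Fin n) ∉ S ∧ h ∉ S ∧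
      ∀ x ∈ S, -x ∈ S := by
  intro j
  induction j with
  | zero => intro _; exact ⟨∅, by simp⟩
  | succ j ih =>
    intro hj
    obtain ⟨S, hc, h0, hhS, hs⟩ := ih (by omega)
    have hex : ∃ x, x ∉ insert 0 (insert h S) := by
      by_contra hcon
      push Not at hcon
      have h1 : (Finset.univ : Finset (Fin n)) ⊆ insert 0 (insert h S) := fun x _ => hcon x
      have h2 := Finset.card_le_card h1
      have h3 := Finset.card_insert_le (0 : Fin n) (insert h S)
      have h4 := Finset.card_insert_le h S
      simp only [Finset.card_univ, Fintype.card_fin] at h2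
      omega
    obtain ⟨x, hx⟩ := hex
    simp only [Finset.mem_insert, not_or] at hx
    obtain ⟨hx0, hxh, hxS⟩ := hx
    have hnx : -x ∉ S := fun hm => hxS (by simpa using hs _ hm)
    have hxv : x.val ≠ 0 := fun e => hx0 (Fin.ext (by simpa using e))
    have hlt := x.isLt
    have hnv : (-x).val = n - x.val := by
      rw [Fin.val_neg']
      exact Nat.mod_eq_of_lt (by omega)
    have hxhv : x.val ≠ h.val := fun e => hxh (Fin.ext e)
    have hne : x ≠ -x := by
      intro e
      have := congrArg Fin.val e
      omega
    have hnh : h ≠ -x := by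
      intro e
      have := congrArg Fin.val e
      omega
    refine ⟨insert x (insert (-x) S), ?_, ?_, ?_, ?_⟩
    · rw [Finset.card_insert_of_notMem, Finset.card_insert_of_notMem hnx, hc]
      · ring
      · simp [hne, hxS]
    · simp only [Finset.mem_insert, not_or]
      exact ⟨fun e => hx0 e.symm, fun e => hx0 (by simpa using e.symm), h0⟩
    · simp only [Finset.mem_insert, not_or]
      exact ⟨fun e => hxh e.symm, hnh, hhS⟩
    · intro y hy
      simp only [Finset.mem_insert] at hy ⊢
      rcases hy with rfl | rfl | hy
      · simp
      · simp
      · exact Or.inr (Or.inr (hs y hy))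

theorem exists_regular (n : ℕ) (hn : 0 < n) (heven : Even n) (k : ℕ) (hk : k ≤ n - 1) :
    ∃ G : SimpleGraph (Fin n), ∀ v, deg G v = k := by
  haveI : NeZero n := ⟨hn.ne'⟩
  obtain ⟨m, hm⟩ := heven
  let h : Fin n := ⟨m, by omega⟩
  have hh : 2 * h.val = n := by simp only [h]; omega
  have hS : ∃ S : Finset (Fin n), S.card = k ∧ (0 : Fin n) ∉ S ∧ ∀ x ∈ S, -x ∈ S := by
    obtain ⟨S, hc, h0, hhS, hs⟩ := exists_symm_set n h hh (k / 2) (by omega)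
    rcases Nat.mod_two_eq_zero_or_one k with e | e
    · exact ⟨S, by omega, h0, hs⟩
    · refine ⟨insert h S, ?_, ?_, ?_⟩
      · rw [Finset.card_insert_of_notMem hhS]; omega
      · simp only [Finset.mem_insert, not_or]
        refine ⟨fun e => ?_, h0⟩
        have := congrArg Fin.val e
        simp only [Fin.val_zero] at this
        omega
      · intro y hy
        simp only [Finset.mem_insert] at hy ⊢
        rcases hy with rfl | hy
        · left
          apply Fin.ext
          rw [Fin.val_neg', Nat.mod_eq_of_lt (by omega)]
          omega
        · exact Or.inr (hs y hy)
  obtain ⟨S, hc, h0, hs⟩ := hS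
  refine ⟨{ Adj := fun v w => w - v ∈ S, symm := ⟨?_⟩, loopless := ⟨?_⟩ }, ?_⟩
  · intro v w hvw
    have := hs _ hvw
    rwa [neg_sub] at this
  · intro v hv
    rw [sub_self] at hv
    exact h0 hv
  · intro v
    unfold deg
    have : {w : Fin n | w - v ∈ S} = (fun x => x + v) '' (S : Set (Fin n)) := by
      ext w
      constructor
      · intro hw
        exact ⟨w - v, hw, sub_add_cancel _ _⟩
      · rintro ⟨x, hx, rfl⟩
        simpa using hx
    change Set.ncard {w : Fin n | w - v ∈ S} = k
    rw [this, Set.ncard_image_of_injective _ (add_left_injective v), Set.ncard_coe_finset, hc]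

theorem deg_le {n : ℕ} (G : SimpleGraph (Fin n)) (v : Fin n) : deg G v ≤ n - 1 := by
  unfold deg
  have h : {w | G.Adj v w} ⊆ ((Finset.univ.erase v : Finset (Fin n)) : Set (Fin n)) := by
    intro w hw
    simpa using (G.ne_of_adj hw).symm
  have := Set.ncard_le_ncard h (Set.toFinite _)
  rw [Set.ncard_coe_finset] at this
  simpa using this

theorem ddp_eq_sum (n : ℕ) (hn : 0 < n) (G : SimpleGraph (Fin n)) :
    ddp n G = ∑ v : Fin n, (1 / (n : ℝ)) • aPoint n (deg G v) := by
  classical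
  have hn' : (n : ℝ) ≠ 0 := by exact_mod_cast hn.ne'
  funext j
  simp only [ddp, Finset.sum_apply, Pi.smul_apply, aPoint, smul_eq_mul, mul_ite, mul_zero]
  rw [one_div, inv_mul_cancel₀ hn', Finset.sum_boole, ← Set.ncard_coe_finset]
  simp [Nat.succ_le_iff]

theorem hull_eq (n : ℕ) (hn : 0 < n) (heven : Even n) :
    convexHull ℝ {x : Fin (n - 1) → ℝ | IsRealizableDDP n x} =
      convexHull ℝ {x | ∃ k ≤ n - 1, x = aPoint n k} := by
  have hn' : (n : ℝ) ≠ 0 := by exact_mod_cast hn.ne'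
  apply Set.Subset.antisymm
  · apply convexHull_min _ (convex_convexHull ℝ _)
    rintro x ⟨G, rfl⟩
    rw [ddp_eq_sum n hn G]
    apply (convex_convexHull ℝ _).sum_mem
    · intros; positivity
    · simp [hn']
    · intro v _
      exact subset_convexHull ℝ _ ⟨_, deg_le G v, rfl⟩
  · apply convexHull_mono
    rintro x ⟨k, hk, rfl⟩
    obtain ⟨G, hG⟩ := exists_regular n hn heven k hk
    refine ⟨G, ?_⟩
    rw [ddp_eq_sum n hn G]
    simp only [hG, Finset.sum_const, Finset.card_univ, Fintype.card_fin]
    rw [← Nat.cast_smul_eq_nsmul ℝ, smul_smul, mul_one_div_cancel hn', one_smul]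

theorem aPoint_extreme (n k : ℕ) :
    aPoint n k ∈ Set.extremePoints ℝ (Set.Icc (0 : Fin (n - 1) → ℝ) (fun _ => (n : ℝ))) := by
  have hn0 : (0 : ℝ) ≤ n := Nat.cast_nonneg n
  rw [mem_extremePoints_iff_left]
  refine ⟨⟨fun j => ?_, fun j => ?_⟩, ?_⟩
  · simp only [aPoint]; split_ifs <;> simp
  · simp only [aPoint]; split_ifs <;> simp
  · rintro x hx y hy ⟨a, b, ha, hb, hab, he⟩
    funext j
    have h1 : a * x j + b * y j = aPoint n k j := by rw [← he]; simp
    have hx0 : 0 ≤ x j := hx.1 j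
    have hx1 : x j ≤ n := hx.2 j
    have hy0 : 0 ≤ y j := hy.1 j
    have hy1 : y j ≤ n := hy.2 j
    simp only [aPoint] at h1 ⊢
    split_ifs at h1 ⊢
    · have e1 : a * (n - x j) + b * (n - y j) = 0 := by
        have : (a + b) * (n : ℝ) = n := by rw [hab, one_mul]
        linarith
      have e2 : 0 ≤ a * (n - x j) := mul_nonneg ha.le (by linarith)
      have e3 : 0 ≤ b * (n - y j) := mul_nonneg hb.le (by linarith)
      have e4 : a * (n - x j) = 0 := by linarith
      have := (mul_eq_zero.mp e4).resolve_left ha.ne'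
      linarith
    · have e2 : 0 ≤ a * x j := mul_nonneg ha.le hx0
      have e3 : 0 ≤ b * y j := mul_nonneg hb.le hy0
      have e4 : a * x j = 0 := by linarith
      exact (mul_eq_zero.mp e4).resolve_left ha.ne'

/-- For even `n`, the extreme points of the convex hull of all realizable dual degree
partitions on `n` vertices are exactly the points `a^(k)`, `k = 0,…,n-1`. -/
theorem extremePoints_ddp_even (n : ℕ) (hn : 0 < n) (heven : Even n) :
    Set.extremePoints ℝ (convexHull ℝ {x : Fin (n - 1) → ℝ | IsRealizableDDP n x}) =
      {x | ∃ k ≤ n - 1, x = aPoint n k} := by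
  rw [hull_eq n hn heven]
  apply Set.Subset.antisymm extremePoints_convexHull_subset
  have hsub : convexHull ℝ {x | ∃ k ≤ n - 1, x = aPoint n k} ⊆
      Set.Icc (0 : Fin (n - 1) → ℝ) (fun _ => (n : ℝ)) := by
    apply convexHull_min _ (convex_Icc _ _)
    rintro x ⟨k, -, rfl⟩
    exact (aPoint_extreme n k).1
  intro x hx
  refine inter_extremePoints_subset_extremePoints_of_subset hsub
    ⟨subset_convexHull ℝ _ hx, ?_⟩
  obtain ⟨k, -, rfl⟩ := hx
  exact aPoint_extreme n k
end

section
/- Let n be an odd positive integer. The convex hull in ℝ^{n−1} of all realizable dual degree partitions on n vertices equals the polytope {x ∈ ℝ^{n−1} : n ≥ x_1 ≥ x_2 ≥ … ≥ x_{n−1} ≥ 0 and (x_1 − x_2) + (x_3 − x_4) + … + (x_{n−2} − x_{n−1}) ≤ n − 1}. -/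
open Classical in
theorem ncard_eq_sum {V : Type*} [Fintype V] (P : V → Prop) :
    Set.ncard {v | P v} = ∑ v, if P v then 1 else 0 := by
  rw [Finset.sum_boole, ← Set.ncard_coe_finset]
  simp

/-- Transfer a graph to `Fin n`. -/
theorem transfer {V : Type*} [Fintype V] (n : ℕ) (hV : Fintype.card V = n) (G : SimpleGraph V) :
    ∃ G' : SimpleGraph (Fin n), ∀ j, ddp n G' j =
      (Set.ncard {v : V | (j : ℕ) + 1 ≤ Set.ncard {w | G.Adj v w}} : ℝ) := by
  classical
  let e : Fin n ≃ V := (Fintype.equivFinOfCardEq hV).symm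
  refine ⟨G.comap e, fun j => ?_⟩
  have hdeg : ∀ v, deg (G.comap e) v = Set.ncard {w | G.Adj (e v) w} := by
    intro v
    unfold deg
    rw [ncard_eq_sum, ncard_eq_sum]
    exact e.sum_comp (fun w => if G.Adj (e v) w then 1 else 0)
  unfold ddp
  congr 1
  simp only [hdeg]
  rw [ncard_eq_sum, ncard_eq_sum]
  convert e.sum_comp (fun v => if (j : ℕ) + 1 ≤ Set.ncard {w | G.Adj v w} then 1 else 0)

/-- Cayley graph on an additive commutative group. -/
def cay {A : Type*} [AddCommGroup A] (D : Set A) (h0 : (0 : A) ∉ D) (hs : ∀ d ∈ D, -d ∈ D) :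
    SimpleGraph A where
  Adj v w := w - v ∈ D
  symm := ⟨fun v w h => by simpa using hs _ h⟩
  loopless := ⟨fun v h => h0 (by simpa using h)⟩

theorem cay_deg {A : Type*} [AddCommGroup A] [Fintype A] (D : Set A) (h0 : (0 : A) ∉ D)
    (hs : ∀ d ∈ D, -d ∈ D) (v : A) : Set.ncard {w | (cay D h0 hs).Adj v w} = D.ncard := by
  classical
  have h := ncard_eq_sum (fun d => d ∈ D)
  rw [ncard_eq_sum]
  refine Eq.trans ?_ h.symm
  exact (Equiv.subRight v).sum_comp (fun d => if d ∈ D then 1 else 0)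

def coned {V : Type*} (H : SimpleGraph V) (σ : V → V) (hσ : ∀ i, σ (σ i) = i)
    (T : Set V) (hT : ∀ i ∈ T, σ i ∈ T) : SimpleGraph (Option V) where
  Adj
    | none, none => False
    | none, some i => i ∈ T
    | some i, none => i ∈ T
    | some i, some j => H.Adj i j ∧ ¬ (j = σ i ∧ i ∈ T)
  symm := ⟨by
    rintro (_ | i) (_ | j) h
    · exact h
    · exact h
    · exact h
    · refine ⟨h.1.symm, ?_⟩
      rintro ⟨rfl, hj⟩
      exact h.2 ⟨(hσ j).symm, hT _ hj⟩⟩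
  loopless := ⟨by
    rintro (_ | i) h
    · exact h
    · exact H.loopless.irrefl _ h.1⟩

theorem coned_none {V : Type*} [Fintype V] (H : SimpleGraph V) (σ : V → V) (hσ : ∀ i, σ (σ i) = i)
    (T : Set V) (hT : ∀ i ∈ T, σ i ∈ T) :
    Set.ncard {w | (coned H σ hσ T hT).Adj none w} = T.ncard := by
  classical
  have h := ncard_eq_sum (fun d => d ∈ T)
  rw [ncard_eq_sum, Fintype.sum_option]
  refine Eq.trans ?_ h.symm
  simp [coned]

theorem coned_some {V : Type*} [Fintype V] (H : SimpleGraph V) (σ : V → V) (hσ : ∀ i, σ (σ i) = i)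
    (T : Set V) (hT : ∀ i ∈ T, σ i ∈ T) (hH : ∀ i, H.Adj i (σ i)) (i : V) :
    Set.ncard {w | (coned H σ hσ T hT).Adj (some i) w} = Set.ncard {w | H.Adj i w} := by
  classical
  rw [ncard_eq_sum, ncard_eq_sum, Fintype.sum_option]
  by_cases hi : i ∈ T
  · simp only [coned, hi, if_true, and_true]
    rw [← Finset.add_sum_erase _ _ (Finset.mem_univ (σ i)),
      ← Finset.add_sum_erase _ _ (Finset.mem_univ (σ i))]
    simp only [hH, if_true, not_true, and_false, if_false, zero_add]
    congr 1
    apply Finset.sum_congr rfl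
    intro j hj
    simp [Finset.ne_of_mem_erase hj]
  · simp [coned, hi]

theorem ncard_nat {N : ℕ} [NeZero N] (S : Finset ℕ) (hS : ∀ a ∈ S, a < N) :
    Set.ncard {d : ZMod N | d.val ∈ S} = S.card := by
  classical
  rw [← Set.ncard_coe_finset S]
  have : (S : Set ℕ) = ZMod.val '' {d : ZMod N | d.val ∈ S} := by
    ext a
    constructor
    · intro ha
      refine ⟨(a : ZMod N), ?_, ZMod.val_cast_of_lt (hS a ha)⟩
      simpa [ZMod.val_cast_of_lt (hS a ha)] using ha
    · rintro ⟨d, hd, rfl⟩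
      exact hd
  rw [this, Set.ncard_image_of_injective _ (ZMod.val_injective N)]

theorem real_even (m k : ℕ) (hk : k ≤ m) :
    ∃ G : SimpleGraph (Fin (2 * m + 1)), ddp (2 * m + 1) G = aPoint (2 * m + 1) (2 * k) := by
  classical
  let S : Finset ℕ := Finset.Icc 1 k ∪ Finset.Ico (2 * m + 1 - k) (2 * m + 1)
  have hS : ∀ a, a ∈ S ↔ (1 ≤ a ∧ a ≤ k) ∨ (2 * m + 1 - k ≤ a ∧ a < 2 * m + 1) := by
    intro a; simp [S]
  have hc : S.card = 2 * k := by
    rw [Finset.card_union_of_disjoint]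
    · simp; omega
    · rw [Finset.disjoint_left]; intro a; simp; omega
  let D : Set (ZMod (2 * m + 1)) := {d | d.val ∈ S}
  have hD : D.ncard = 2 * k := by
    rw [← hc]; apply ncard_nat; intro a; rw [hS]; omega
  have h0 : (0 : ZMod (2 * m + 1)) ∉ D := by
    simp only [D, Set.mem_ofPred_eq, hS, ZMod.val_zero]; omega
  have hs : ∀ d ∈ D, -d ∈ D := by
    intro d hd
    have hne : d ≠ 0 := fun h => h0 (h ▸ hd)
    have : NeZero d := ⟨hne⟩
    have := ZMod.val_lt d
    simp only [D, Set.mem_ofPred_eq, hS, ZMod.val_neg_of_ne_zero] at hd ⊢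
    omega
  obtain ⟨G, hG⟩ := transfer (2 * m + 1) (ZMod.card _) (cay D h0 hs)
  refine ⟨G, funext fun j => ?_⟩
  rw [hG]
  simp only [cay_deg, hD, aPoint]
  by_cases h : (j : ℕ) < 2 * k
  · rw [if_pos h, show {v : ZMod (2 * m + 1) | (j : ℕ) + 1 ≤ 2 * k} = Set.univ by
      ext; simp; omega]
    simp [Set.ncard_univ]
  · rw [if_neg h, show {v : ZMod (2 * m + 1) | (j : ℕ) + 1 ≤ 2 * k} = ∅ by
      ext; simp; omega]
    simp

theorem real_mix (m e o : ℕ) (he : e ≤ m) (ho : o < m) :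
    ∃ G : SimpleGraph (Fin (2 * m + 1)), ddp (2 * m + 1) G = fun j : Fin (2 * m + 1 - 1) =>
      (if (j : ℕ) < 2 * e then (1 : ℝ) else 0) +
      (if (j : ℕ) < 2 * o + 1 then (2 * m : ℝ) else 0) := by
  classical
  have : NeZero (2 * m) := ⟨by omega⟩
  let S : Finset ℕ := (Finset.Icc 1 o ∪ Finset.Ico (2 * m - o) (2 * m)) ∪ {m}
  have hS : ∀ a, a ∈ S ↔ ((1 ≤ a ∧ a ≤ o) ∨ (2 * m - o ≤ a ∧ a < 2 * m)) ∨ a = m := by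
    intro a; simp [S]; tauto
  have hc : S.card = 2 * o + 1 := by
    rw [Finset.card_union_of_disjoint, Finset.card_union_of_disjoint]
    · simp; omega
    · rw [Finset.disjoint_left]; intro a; simp; omega
    · rw [Finset.disjoint_left]; intro a; simp; omega
  let D : Set (ZMod (2 * m)) := {d | d.val ∈ S}
  have hD : D.ncard = 2 * o + 1 := by
    rw [← hc]; apply ncard_nat; intro a; rw [hS]; omega
  have h0 : (0 : ZMod (2 * m)) ∉ D := by
    simp only [D, Set.mem_ofPred_eq, hS, ZMod.val_zero]; omega
  have hs : ∀ d ∈ D, -d ∈ D := by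
    intro d hd
    have hne : d ≠ 0 := fun h => h0 (h ▸ hd)
    have : NeZero d := ⟨hne⟩
    have := ZMod.val_lt d
    simp only [D, Set.mem_ofPred_eq, hS, ZMod.val_neg_of_ne_zero] at hd ⊢
    omega
  have hmv : ((m : ℕ) : ZMod (2 * m)).val = m := ZMod.val_cast_of_lt (by omega)
  let U : Finset ℕ := Finset.range e ∪ Finset.Ico m (m + e)
  have hU : ∀ a, a ∈ U ↔ a < e ∨ (m ≤ a ∧ a < m + e) := by intro a; simp [U]
  have hUc : U.card = 2 * e := by
    rw [Finset.card_union_of_disjoint]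
    · simp; omega
    · rw [Finset.disjoint_left]; intro a; simp; omega
  let T : Set (ZMod (2 * m)) := {d | d.val ∈ U}
  have hTc : T.ncard = 2 * e := by
    rw [← hUc]; apply ncard_nat; intro a; rw [hU]; omega
  let σ : ZMod (2 * m) → ZMod (2 * m) := fun i => i + (m : ℕ)
  have hσ : ∀ i, σ (σ i) = i := by
    intro i
    have : ((m : ℕ) : ZMod (2 * m)) + (m : ℕ) = 0 := by
      rw [← Nat.cast_add, ← two_mul]; exact ZMod.natCast_self _
    simp only [σ, add_assoc, this, add_zero]
  have hT : ∀ i ∈ T, σ i ∈ T := by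
    intro i hi
    have hlt := ZMod.val_lt i
    simp only [T, σ, Set.mem_ofPred_eq, hU] at hi ⊢
    by_cases h : i.val < m
    · rw [ZMod.val_add_of_lt (by omega), hmv]; omega
    · have := ZMod.val_add_val_of_le (a := i) (b := ((m : ℕ) : ZMod (2 * m))) (by omega)
      omega
  have hH : ∀ i, (cay D h0 hs).Adj i (σ i) := by
    intro i
    show σ i - i ∈ D
    simp only [D, σ, Set.mem_ofPred_eq, hS, add_sub_cancel_left, hmv]
    simp
  obtain ⟨G, hG⟩ := transfer (V := Option (ZMod (2 * m))) (2 * m + 1) (by simp [ZMod.card])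
    (coned (cay D h0 hs) σ hσ T hT)
  refine ⟨G, funext fun j => ?_⟩
  rw [hG, ncard_eq_sum, Fintype.sum_option]
  simp only [coned_none, coned_some _ _ _ _ _ hH, cay_deg, hD, hTc, Nat.succ_le_iff,
    Finset.sum_const, Finset.card_univ, ZMod.card, Nat.add_one_le_iff]
  push_cast
  split_ifs <;> simp

theorem aPoint_mix (m e o : ℕ) (he : e ≤ m) (ho : o < m) :
    ∃ G : SimpleGraph (Fin (2 * m + 1)), ddp (2 * m + 1) G =
      (1 / (2 * m + 1 : ℝ)) • aPoint (2 * m + 1) (2 * e) +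
      (2 * m / (2 * m + 1 : ℝ)) • aPoint (2 * m + 1) (2 * o + 1) := by
  obtain ⟨G, hG⟩ := real_mix m e o he ho
  refine ⟨G, hG.trans (funext fun j => ?_)⟩
  have : (2 * m + 1 : ℝ) ≠ 0 := by positivity
  simp only [aPoint, Pi.add_apply, Pi.smul_apply, smul_eq_mul]
  push_cast
  split_ifs <;> field_simp <;> simp

theorem sum_split (f : ℕ → ℝ) (m : ℕ) : ∑ k ∈ Finset.range (2 * m + 1), f k =
    ∑ i ∈ Finset.range (m + 1), f (2 * i) + ∑ i ∈ Finset.range m, f (2 * i + 1) := by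
  induction m with
  | zero => simp
  | succ m ih =>
    rw [show 2 * (m + 1) + 1 = 2 * m + 1 + 1 + 1 by ring, Finset.sum_range_succ,
      Finset.sum_range_succ, ih, Finset.sum_range_succ _ (m + 1),
      Finset.sum_range_succ (fun i => f (2 * i + 1)) m, show 2 * (m + 1) = 2 * m + 1 + 1 by ring]
    ring

/-- abstract convexity argument -/
theorem hull_arg {E : Type*} [AddCommGroup E] [Module ℝ E] (H : Set E) (hH : Convex ℝ H) (m : ℕ)
    (a b : ℕ → E) (ha : ∀ i ≤ m, a i ∈ H)
    (hab : ∀ i ≤ m, ∀ j < m, (1 / (2 * m + 1 : ℝ)) • a i + (2 * m / (2 * m + 1 : ℝ)) • b j ∈ H)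
    (p q : ℕ → ℝ) (hp : ∀ i ≤ m, 0 ≤ p i) (hq : ∀ i < m, 0 ≤ q i)
    (h1 : ∑ i ∈ Finset.range (m + 1), p i + ∑ i ∈ Finset.range m, q i = 1)
    (hle : (2 * m + 1) * ∑ i ∈ Finset.range m, q i ≤ 2 * m) :
    ∑ i ∈ Finset.range (m + 1), p i • a i + ∑ i ∈ Finset.range m, q i • b i ∈ H := by
  set P := ∑ i ∈ Finset.range (m + 1), p i with hP
  set Q := ∑ i ∈ Finset.range m, q i with hQ
  have hn : (0 : ℝ) < 2 * m + 1 := by positivity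
  have hQ0 : 0 ≤ Q := Finset.sum_nonneg fun i hi => hq i (Finset.mem_range.1 hi)
  have hPpos : 0 < P := by
    by_contra h
    have : 1 ≤ Q := by linarith
    nlinarith
  have avg : ∀ (K : Set E), Convex ℝ K → ∀ (N : ℕ) (w : ℕ → ℝ) (z : ℕ → E),
      (∀ i < N, 0 ≤ w i) → (∀ i < N, z i ∈ K) → 0 < ∑ i ∈ Finset.range N, w i →
      (∑ i ∈ Finset.range N, w i)⁻¹ • ∑ i ∈ Finset.range N, w i • z i ∈ K := by
    intro K hK N w z hw hz hpos
    exact hK.centerMass_mem (fun i hi => hw i (Finset.mem_range.1 hi)) hpos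
      (fun i hi => hz i (Finset.mem_range.1 hi))
  have hA := avg H hH (m + 1) p a (fun i hi => hp i (by omega)) (fun i hi => ha i (by omega)) hPpos
  rw [← hP] at hA
  set A := ∑ i ∈ Finset.range (m + 1), p i • a i with hAdef
  set B := ∑ i ∈ Finset.range m, q i • b i with hBdef
  rcases hQ0.eq_or_lt with h | hQpos
  · have hB : B = 0 := by
      apply Finset.sum_eq_zero
      intro i hi
      have := (Finset.sum_eq_zero_iff_of_nonneg
        (fun i hi => hq i (Finset.mem_range.1 hi))).1 h.symm i hi
      simp [this]
    have : P = 1 := by linarith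
    rw [this] at hA
    simpa [hB] using hA
  · set s := (1 / (2 * m + 1 : ℝ)) with hs
    set t := (2 * m / (2 * m + 1 : ℝ)) with ht
    have step1 : ∀ i ≤ m, s • a i + t • (Q⁻¹ • B) ∈ H := by
      intro i hi
      have hK : Convex ℝ {y : E | s • a i + t • y ∈ H} := by
        intro y hy z hz α β hα hβ hαβ
        have := hH hy hz hα hβ hαβ
        simp only [Set.mem_ofPred_eq] at this ⊢
        convert this using 1
        obtain rfl : β = 1 - α := by linarith
        module
      exact avg _ hK m q b hq (fun j hj => hab i hi j hj) hQpos
    have step2 : s • (P⁻¹ • A) + t • (Q⁻¹ • B) ∈ H := by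
      have hK : Convex ℝ {y : E | s • y + t • (Q⁻¹ • B) ∈ H} := by
        intro y hy z hz α β hα hβ hαβ
        have := hH hy hz hα hβ hαβ
        simp only [Set.mem_ofPred_eq] at this ⊢
        convert this using 1
        obtain rfl : β = 1 - α := by linarith
        module
      exact avg _ hK (m + 1) p a (fun i hi => hp i (by omega))
        (fun j hj => step1 j (by omega)) hPpos
    have hm : (0 : ℝ) < 2 * m := by
      have : 0 < (2 * m + 1) * Q := by positivity
      linarith
    have hcoef : (0 : ℝ) ≤ 1 - (2 * m + 1) * Q / (2 * m) := by
      rw [sub_nonneg, div_le_one hm]; exact hle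
    have := hH hA step2 hcoef (b := (2 * m + 1) * Q / (2 * m)) (by positivity) (by ring)
    convert this using 1
    have hm0 : (m : ℝ) ≠ 0 := by intro h; simp [h] at hm
    have hPQ : P = 1 - Q := by linarith
    have e1 : A = (P * P⁻¹) • A := by rw [mul_inv_cancel₀ hPpos.ne', one_smul]
    have e2 : B = (Q * Q⁻¹) • B := by rw [mul_inv_cancel₀ hQpos.ne', one_smul]
    have c2 : (2 * m + 1) * Q / (2 * m) * t = Q := by rw [ht]; field_simp
    have c1 : (1 - (2 * m + 1) * Q / (2 * m)) + (2 * m + 1) * Q / (2 * m) * s = P := by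
      rw [hPQ, hs]; field_simp; ring
    rw [smul_add, smul_smul _ t, c2, smul_smul _ s, ← add_assoc, ← add_smul, c1, smul_smul,
      smul_smul, ← e1, ← e2]

theorem deg_eq {n : ℕ} (G : SimpleGraph (Fin n)) [DecidableRel G.Adj] (v : Fin n) :
    deg G v = G.degree v := by
  unfold deg
  rw [← SimpleGraph.card_neighborFinset_eq_degree, ← Set.ncard_coe_finset]
  congr 1
  ext w; simp

theorem altSum_ddp (m : ℕ) (G : SimpleGraph (Fin (2 * m + 1))) :
    altSum (2 * m + 1) (ddp (2 * m + 1) G) ≤ 2 * m := by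
  classical
  have key : ∀ k, (Set.ncard {v | k ≤ deg G v} : ℝ) - Set.ncard {v | k + 1 ≤ deg G v} =
      ((Finset.univ.filter fun v => deg G v = k).card : ℝ) := by
    intro k
    rw [ncard_eq_sum, ncard_eq_sum, Finset.card_filter]
    push_cast
    rw [← Finset.sum_sub_distrib]
    apply Finset.sum_congr rfl
    intro v _
    split_ifs <;> first | omega | simp
  have h1 : altSum (2 * m + 1) (ddp (2 * m + 1) G) =
      ((∑ i ∈ Finset.range m, (Finset.univ.filter fun v => deg G v = 2 * i + 1).card : ℕ) : ℝ) := by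
    unfold altSum
    rw [show (2 * m + 1 - 1) / 2 = m by omega, Nat.cast_sum]
    apply Finset.sum_congr rfl
    intro i hi
    have hi := Finset.mem_range.1 hi
    rw [dif_pos (by omega), dif_pos (by omega), ← key]
    rfl
  rw [h1, ← Finset.card_biUnion]
  · have hev : Even (Finset.univ.filter fun v => Odd (deg G v)).card := by
      simp only [deg_eq]
      exact G.even_card_odd_degree_vertices
    have hle : (Finset.univ.filter fun v => Odd (deg G v)).card ≤ 2 * m + 1 := by
      simpa using Finset.card_le_univ (Finset.univ.filter fun v => Odd (deg G v))
    have hsub : ((Finset.range m).biUnion fun i =>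
        Finset.univ.filter fun v => deg G v = 2 * i + 1) ⊆
        Finset.univ.filter fun v => Odd (deg G v) := by
      intro v hv
      simp only [Finset.mem_biUnion, Finset.mem_filter, Finset.mem_univ, true_and] at hv ⊢
      obtain ⟨i, _, h⟩ := hv
      exact ⟨i, h⟩
    have := Finset.card_le_card hsub
    obtain ⟨r, hr⟩ := hev
    have : ((Finset.range m).biUnion fun i =>
        Finset.univ.filter fun v => deg G v = 2 * i + 1).card ≤ 2 * m := by omega
    exact_mod_cast this
  · intro i _ j _ hij
    rw [Function.onFun, Finset.disjoint_left]
    intro v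
    simp only [Finset.mem_filter, Finset.mem_univ, true_and]
    omega

theorem ddp_mem_Rpoly (n : ℕ) (G : SimpleGraph (Fin n)) : ddp n G ∈ Rpoly n := by
  refine ⟨fun i => ?_, fun i => by unfold ddp; positivity, fun i j hij => ?_⟩
  · unfold ddp
    have := Set.ncard_le_card {v : Fin n | (i : ℕ) + 1 ≤ deg G v}
    exact_mod_cast (by simpa using this)
  · unfold ddp
    have : Set.ncard {v : Fin n | (j : ℕ) + 1 ≤ deg G v} ≤
        Set.ncard {v : Fin n | (i : ℕ) + 1 ≤ deg G v} := by
      apply Set.ncard_le_ncard _ (Set.toFinite _)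
      intro v hv
      simp only [Set.mem_ofPred_eq] at hv ⊢
      have : (i : ℕ) ≤ j := hij
      omega
    exact_mod_cast this

theorem convex_poly (n : ℕ) : Convex ℝ (Rpoly n ∩ {x | altSum n x ≤ (n : ℝ) - 1}) := by
  have halt : ∀ (x y : Fin (n - 1) → ℝ) (α β : ℝ),
      altSum n (α • x + β • y) = α * altSum n x + β * altSum n y := by
    intro x y α β
    unfold altSum
    rw [Finset.mul_sum, Finset.mul_sum, ← Finset.sum_add_distrib]
    apply Finset.sum_congr rfl
    intro i _
    simp only [Pi.add_apply, Pi.smul_apply, smul_eq_mul]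
    split_ifs <;> ring
  rintro x ⟨⟨hx1, hx2, hx3⟩, hx4⟩ y ⟨⟨hy1, hy2, hy3⟩, hy4⟩ α β hα hβ hαβ
  have hβ' : β = 1 - α := by linarith
  refine ⟨⟨fun i => ?_, fun i => ?_, fun i j hij => ?_⟩, ?_⟩
  · simp only [Pi.add_apply, Pi.smul_apply, smul_eq_mul]
    have := mul_le_mul_of_nonneg_left (hx1 i) hα
    have := mul_le_mul_of_nonneg_left (hy1 i) hβ
    have : α * (n : ℝ) + β * n = n := by rw [← add_mul, hαβ, one_mul]
    linarith
  · simp only [Pi.add_apply, Pi.smul_apply, smul_eq_mul]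
    have := mul_nonneg hα (hx2 i)
    have := mul_nonneg hβ (hy2 i)
    linarith
  · simp only [Pi.add_apply, Pi.smul_apply, smul_eq_mul]
    have := mul_le_mul_of_nonneg_left (hx3 i j hij) hα
    have := mul_le_mul_of_nonneg_left (hy3 i j hij) hβ
    linarith
  · simp only [Set.mem_ofPred_eq] at hx4 hy4 ⊢
    rw [halt]
    have := mul_le_mul_of_nonneg_left hx4 hα
    have := mul_le_mul_of_nonneg_left hy4 hβ
    have : α * ((n : ℝ) - 1) + β * (n - 1) = n - 1 := by rw [← add_mul, hαβ, one_mul]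
    linarith

theorem sum_tail (X : ℕ → ℝ) (N j : ℕ) (hj : j < N) :
    ∑ k ∈ Finset.range N, (if j < k then X k - X (k + 1) else 0) = X (j + 1) - X N := by
  induction N, hj using Nat.le_induction with
  | base =>
    rw [Finset.sum_eq_zero]
    · simp
    · intro k hk
      have := Finset.mem_range.1 hk
      rw [if_neg (by omega)]
  | succ N hN ih =>
    rw [Finset.sum_range_succ, ih, if_pos (by omega)]
    ring

theorem mem_hull (m : ℕ) (x : Fin (2 * m + 1 - 1) → ℝ) (hx : x ∈ Rpoly (2 * m + 1))
    (hx4 : altSum (2 * m + 1) x ≤ 2 * m) :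
    x ∈ convexHull ℝ {x : Fin (2 * m + 1 - 1) → ℝ | IsRealizableDDP (2 * m + 1) x} := by
  obtain ⟨hx1, hx2, hx3⟩ := hx
  have hn : (0 : ℝ) < 2 * m + 1 := by positivity
  let X : ℕ → ℝ := fun k => if k = 0 then 2 * m + 1 else
    if h : k - 1 < 2 * m + 1 - 1 then x ⟨k - 1, h⟩ else 0
  have hX0 : X 0 = 2 * m + 1 := by simp [X]
  have hXs : ∀ k (h : k < 2 * m + 1 - 1), X (k + 1) = x ⟨k, h⟩ := by
    intro k h
    have : k < 2 * m := by omega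
    simp [X, this]
  have hXn : X (2 * m + 1) = 0 := by simp [X]
  have hmono : ∀ k < 2 * m + 1, 0 ≤ X k - X (k + 1) := by
    intro k hk
    rw [sub_nonneg]
    rcases k with _ | k
    · rw [hX0]
      by_cases h : 0 < 2 * m + 1 - 1
      · rw [hXs 0 h]
        have := hx1 ⟨0, h⟩
        push_cast at this
        exact this
      · have : m = 0 := by omega
        subst this
        simp [X]
    · rw [hXs k (by omega)]
      by_cases h : k + 1 < 2 * m + 1 - 1
      · rw [hXs (k + 1) h]
        exact hx3 _ _ (by simp)
      · have : k + 1 + 1 = 2 * m + 1 := by omega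
        rw [this, hXn]
        exact hx2 _
  let l : ℕ → ℝ := fun k => (X k - X (k + 1)) / (2 * m + 1)
  have hl : ∀ k < 2 * m + 1, 0 ≤ l k := fun k hk => div_nonneg (hmono k hk) hn.le
  have hsum : ∑ k ∈ Finset.range (2 * m + 1), l k = 1 := by
    simp only [l]
    rw [← Finset.sum_div, Finset.sum_range_sub', hX0, hXn, sub_zero, div_self hn.ne']
  have hxeq : x = ∑ k ∈ Finset.range (2 * m + 1), l k • aPoint (2 * m + 1) k := by
    funext j
    have hj := j.2
    have := sum_tail X (2 * m + 1) j (by omega)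
    rw [hXn, sub_zero, hXs j j.2] at this
    rw [Finset.sum_apply]
    refine this.symm.trans (Finset.sum_congr rfl fun k _ => ?_)
    simp only [Pi.smul_apply, aPoint, smul_eq_mul, l]
    push_cast
    split_ifs
    · field_simp
    · simp
  have halt : altSum (2 * m + 1) x = (2 * m + 1) * ∑ i ∈ Finset.range m, l (2 * i + 1) := by
    unfold altSum
    rw [show (2 * m + 1 - 1) / 2 = m by omega, Finset.mul_sum]
    apply Finset.sum_congr rfl
    intro i hi
    have hi := Finset.mem_range.1 hi
    rw [dif_pos (by omega), dif_pos (by omega), ← hXs, ← hXs]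
    simp only [l]
    field_simp
  have hxeq2 : x = ∑ i ∈ Finset.range (m + 1), l (2 * i) • aPoint (2 * m + 1) (2 * i) +
      ∑ i ∈ Finset.range m, l (2 * i + 1) • aPoint (2 * m + 1) (2 * i + 1) := by
    funext j
    conv_lhs => rw [hxeq]
    simp only [Pi.add_apply, Finset.sum_apply]
    exact sum_split (fun k => (l k • aPoint (2 * m + 1) k) j) m
  rw [hxeq2]
  apply hull_arg _ (convex_convexHull ℝ _) m (fun i => aPoint (2 * m + 1) (2 * i))
    (fun i => aPoint (2 * m + 1) (2 * i + 1)) ?_ ?_ (fun i => l (2 * i)) (fun i => l (2 * i + 1))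
  · exact fun i hi => hl _ (by omega)
  · exact fun i hi => hl _ (by omega)
  · rw [← hsum]; exact (sum_split l m).symm
  · rw [← halt]; exact hx4
  · intro i hi
    obtain ⟨G, hG⟩ := real_even m i hi
    exact subset_convexHull ℝ _ ⟨G, hG.symm⟩
  · intro i hi j hj
    obtain ⟨G, hG⟩ := aPoint_mix m i j hi hj
    exact subset_convexHull ℝ _ ⟨G, hG.symm⟩

/-- For odd `n`, the convex hull of all realizable dual degree partitions on `n`
vertices is the polytope `{x : n ≥ x_1 ≥ ⋯ ≥ x_{n-1} ≥ 0` and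
`(x_1-x_2)+(x_3-x_4)+⋯+(x_{n-2}-x_{n-1}) ≤ n-1}`. -/
theorem convexHull_ddp_odd (n : ℕ) (hn : 0 < n) (hodd : Odd n) :
    convexHull ℝ {x : Fin (n - 1) → ℝ | IsRealizableDDP n x} =
      Rpoly n ∩ {x | altSum n x ≤ (n : ℝ) - 1} := by
  obtain ⟨m, rfl⟩ := hodd
  apply Set.Subset.antisymm
  · apply convexHull_min _ (convex_poly _)
    rintro x ⟨G, rfl⟩
    refine ⟨ddp_mem_Rpoly _ G, ?_⟩
    have := altSum_ddp m G
    simp only [Set.mem_ofPred_eq]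
    push_cast
    linarith
  · rintro x ⟨hx, hx4⟩
    refine mem_hull m x hx ?_
    simp only [Set.mem_ofPred_eq] at hx4
    push_cast at hx4
    linarith
end

section
/- Let n be an odd positive integer. The convex hull in ℝ^{n−1} of the (n+1)²/4 points a^(k) (0 ≤ 2k ≤ n−1), b^(k,l) (k, l ≥ 0, 2k+2l ≤ n−3), and c^(k,l) (k, l ≥ 0, 2k+2l ≤ n−3) equals the polytope {x ∈ ℝ^{n−1} : n ≥ x_1 ≥ … ≥ x_{n−1} ≥ 0 and (x_1 − x_2) + (x_3 − x_4) + … + (x_{n−2} − x_{n−1}) ≤ n − 1}, where a^(k) = (n,…,n,0,…,0) with 2k entries n and n−1−2k zeros; b^(k,l) = (n,…,n,n−1,…,n−1,0,…,0) with 2k entries n, then 2l+1 entries n−1, then n−2−2k−2l zeros; and c^(k,l) = (n,…,n,1,…,1,0,…,0) with 2k+1 entries n, then 2l+1 entries 1, then n−3−2k−2l zeros. -/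
theorem altSum_comb (n : ℕ) (x y : Fin (n - 1) → ℝ) (a b : ℝ) :
    altSum n (a • x + b • y) = a * altSum n x + b * altSum n y := by
  unfold altSum
  rw [Finset.mul_sum, Finset.mul_sum, ← Finset.sum_add_distrib]
  refine Finset.sum_congr rfl fun i _ => ?_
  split_ifs <;> simp <;> ring

theorem altSum_aPoint_even (n m : ℕ) : altSum n (aPoint n (2 * m)) = 0 := by
  unfold altSum aPoint
  refine Finset.sum_eq_zero fun i hi => ?_
  rw [Finset.mem_range] at hi
  have h1 : 2 * i < n - 1 := by omega
  have h2 : 2 * i + 1 < n - 1 := by omega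
  simp only [h1, h2, dite_true]
  by_cases h : i < m
  · rw [if_pos (by omega), if_pos (by omega), sub_self]
  · rw [if_neg (by omega), if_neg (by omega), sub_self]

theorem altSum_aPoint_odd (n m : ℕ) (hm : 2 * m + 2 < n) :
    altSum n (aPoint n (2 * m + 1)) = n := by
  unfold altSum aPoint
  rw [Finset.sum_eq_single m]
  · have h1 : 2 * m < n - 1 := by omega
    have h2 : 2 * m + 1 < n - 1 := by omega
    simp [h1, h2]
  · intro i hi hne
    rw [Finset.mem_range] at hi
    have h1 : 2 * i < n - 1 := by omega
    have h2 : 2 * i + 1 < n - 1 := by omega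
    simp only [h1, h2, dite_true]
    by_cases h : i < m
    · rw [if_pos (by omega), if_pos (by omega), sub_self]
    · rw [if_neg (by omega), if_neg (by omega), sub_self]
  · intro h
    exact absurd (Finset.mem_range.2 (by omega)) h

theorem aPoint_mem_Rpoly (n j : ℕ) : aPoint n j ∈ Rpoly n := by
  have h0 : (0 : ℝ) ≤ n := Nat.cast_nonneg n
  refine ⟨fun i => ?_, fun i => ?_, fun i k hik => ?_⟩
  · unfold aPoint; split_ifs <;> simp
  · unfold aPoint; split_ifs <;> simp
  · have hik' : (i : ℕ) ≤ k := hik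
    unfold aPoint
    split_ifs
    · exact le_rfl
    · omega
    · exact h0
    · exact le_rfl

theorem convex_Rpoly (n : ℕ) : Convex ℝ (Rpoly n) := by
  rintro x ⟨hx1, hx2, hx3⟩ y ⟨hy1, hy2, hy3⟩ a b ha hb hab
  refine ⟨fun i => ?_, fun i => ?_, fun i k hik => ?_⟩
  · have := mul_le_mul_of_nonneg_left (hx1 i) ha
    have := mul_le_mul_of_nonneg_left (hy1 i) hb
    have : a * n + b * n = (n : ℝ) := by rw [← add_mul, hab, one_mul]
    simp only [Pi.add_apply, Pi.smul_apply, smul_eq_mul]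
    linarith
  · have := mul_nonneg ha (hx2 i)
    have := mul_nonneg hb (hy2 i)
    simp only [Pi.add_apply, Pi.smul_apply, smul_eq_mul]
    linarith
  · have := mul_le_mul_of_nonneg_left (hx3 i k hik) ha
    have := mul_le_mul_of_nonneg_left (hy3 i k hik) hb
    simp only [Pi.add_apply, Pi.smul_apply, smul_eq_mul]
    linarith

theorem bPoint_eq (n k l : ℕ) (hn : 0 < n) :
    bPoint n k l = (1 / (n : ℝ)) • aPoint n (2 * k)
      + (((n : ℝ) - 1) / n) • aPoint n (2 * (k + l) + 1) := by
  have h0 : (n : ℝ) ≠ 0 := by positivity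
  ext j
  simp only [bPoint, aPoint, Pi.add_apply, Pi.smul_apply, smul_eq_mul]
  split_ifs
  all_goals first | omega | (field_simp <;> ring)

theorem cPoint_eq (n k l : ℕ) (hn : 0 < n) :
    cPoint n k l = (1 / (n : ℝ)) • aPoint n (2 * (k + l + 1))
      + (((n : ℝ) - 1) / n) • aPoint n (2 * k + 1) := by
  have h0 : (n : ℝ) ≠ 0 := by positivity
  ext j
  simp only [cPoint, aPoint, Pi.add_apply, Pi.smul_apply, smul_eq_mul]
  split_ifs
  all_goals first | omega | (field_simp <;> ring)

/-- The simplex description of `Rpoly`. -/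
theorem Rpoly_subset (n : ℕ) (hn : 0 < n) :
    Rpoly n ⊆ convexHull ℝ {x | ∃ j < n, x = aPoint n j} := by
  rintro x ⟨hx1, hx2, hx3⟩
  have hpos : (0 : ℝ) < n := by positivity
  let X : ℕ → ℝ := fun j => if j = 0 then (n : ℝ) else
    if h : j - 1 < n - 1 then x ⟨j - 1, h⟩ else 0
  have hX0 : X 0 = n := by simp [X]
  have hXn : X n = 0 := by simp [X, hn.ne']
  have hmono : ∀ j, X (j + 1) ≤ X j := by
    intro j
    rcases j with _ | j
    · simp only [X]
      simp only [Nat.add_sub_cancel, if_true, zero_add, one_ne_zero, if_false]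
      split_ifs
      · exact hx1 _
      · exact hpos.le
    · simp only [X, Nat.add_sub_cancel, Nat.succ_ne_zero, if_false]
      split_ifs
      · exact hx3 _ _ (by simp [Fin.le_def])
      · omega
      · exact hx2 _
      · exact le_rfl
  have hsum : x = ∑ j ∈ Finset.range n, ((X j - X (j + 1)) / n) • aPoint n j := by
    ext i
    have hi := i.2
    rw [Finset.sum_apply]
    simp only [Pi.smul_apply, smul_eq_mul, aPoint]
    have e1 : ∀ j ∈ Finset.range n, (X j - X (j + 1)) / n * (if (i : ℕ) < j then (n : ℝ) else 0)
        = if (i : ℕ) < j then X j - X (j + 1) else 0 := by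
      intro j _
      split_ifs
      · field_simp
      · simp
    rw [Finset.sum_congr rfl e1, ← Finset.sum_filter]
    have e2 : (Finset.range n).filter (fun j => (i : ℕ) < j) = Finset.Ico ((i : ℕ) + 1) n := by
      ext j; simp; omega
    rw [e2]
    have e3 := Finset.sum_Ico_sub X (show (i : ℕ) + 1 ≤ n by omega)
    have e4 : ∑ j ∈ Finset.Ico ((i : ℕ) + 1) n, (X j - X (j + 1))
        = -∑ j ∈ Finset.Ico ((i : ℕ) + 1) n, (X (j + 1) - X j) := by
      rw [← Finset.sum_neg_distrib]
      exact Finset.sum_congr rfl fun _ _ => by ring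
    rw [e4, e3, hXn]
    simp [X]
  rw [hsum]
  refine (convex_convexHull ℝ _).sum_mem ?_ ?_ ?_
  · intro j _
    exact div_nonneg (sub_nonneg.2 (hmono j)) hpos.le
  · rw [← Finset.sum_div, Finset.sum_range_sub', hX0, hXn, sub_zero, div_self hpos.ne']
  · intro j hj
    exact subset_convexHull ℝ _ ⟨j, Finset.mem_range.1 hj, rfl⟩

open scoped Pointwise in
theorem comb_mem {E : Type*} [AddCommGroup E] [Module ℝ E] (A B H : Set E) (hH : Convex ℝ H)
    (s t : ℝ) (hAB : ∀ a ∈ A, ∀ b ∈ B, s • a + t • b ∈ H) :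
    ∀ p ∈ convexHull ℝ A, ∀ q ∈ convexHull ℝ B, s • p + t • q ∈ H := by
  have h1 : s • A + t • B ⊆ H := by
    rintro _ ⟨_, ⟨a, ha, rfl⟩, _, ⟨b, hb, rfl⟩, rfl⟩
    exact hAB a ha b hb
  intro p hp q hq
  have h2 := convexHull_min h1 hH
  rw [convexHull_add, convexHull_smul, convexHull_smul] at h2
  exact h2 (Set.add_mem_add (Set.smul_mem_smul_set hp) (Set.smul_mem_smul_set hq))

/-- For odd `n`, the convex hull of the points `a^(k)` (`0 ≤ 2k ≤ n-1`), `b^(k,l)` and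
`c^(k,l)` (`k, l ≥ 0`, `2k+2l ≤ n-3`) equals the polytope
`{x : n ≥ x_1 ≥ ⋯ ≥ x_{n-1} ≥ 0, (x_1-x_2)+⋯+(x_{n-2}-x_{n-1}) ≤ n-1}`. -/
theorem convexHull_points_odd (n : ℕ) (hn : 0 < n) (hodd : Odd n) :
    convexHull ℝ {x : Fin (n - 1) → ℝ |
        (∃ k : ℕ, 2 * k ≤ n - 1 ∧ x = aPoint n (2 * k)) ∨
        (∃ k l : ℕ, 2 * k + 2 * l + 3 ≤ n ∧ x = bPoint n k l) ∨
        (∃ k l : ℕ, 2 * k + 2 * l + 3 ≤ n ∧ x = cPoint n k l)} =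
      Rpoly n ∩ {x | altSum n x ≤ (n : ℝ) - 1} := by
  have hpos : (0 : ℝ) < n := by positivity
  have hn1 : (1 : ℝ) ≤ n := by exact_mod_cast hn
  apply Set.Subset.antisymm
  · have hc : Convex ℝ (Rpoly n ∩ {x | altSum n x ≤ (n : ℝ) - 1}) := by
      refine (convex_Rpoly n).inter ?_
      intro x hx y hy a b ha hb hab
      simp only [Set.mem_ofPred_eq] at hx hy ⊢
      rw [altSum_comb]
      have := mul_le_mul_of_nonneg_left hx ha
      have := mul_le_mul_of_nonneg_left hy hb
      have : a * ((n : ℝ) - 1) + b * (n - 1) = (n : ℝ) - 1 := by rw [← add_mul, hab, one_mul]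
      linarith
    have hv : ∀ e o : ℕ, 2 * o + 2 < n → (1 / (n : ℝ)) • aPoint n (2 * e)
        + (((n : ℝ) - 1) / n) • aPoint n (2 * o + 1) ∈
        Rpoly n ∩ {x | altSum n x ≤ (n : ℝ) - 1} := by
      intro e o ho
      refine ⟨convex_Rpoly n (aPoint_mem_Rpoly _ _) (aPoint_mem_Rpoly _ _) (by positivity)
        (div_nonneg (by linarith) hpos.le) (by field_simp; ring), ?_⟩
      simp only [Set.mem_ofPred_eq]
      rw [altSum_comb, altSum_aPoint_even, altSum_aPoint_odd n o ho]
      apply le_of_eq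
      field_simp
      ring
    refine convexHull_min ?_ hc
    rintro x (⟨k, hk, rfl⟩ | ⟨k, l, hkl, rfl⟩ | ⟨k, l, hkl, rfl⟩)
    · refine ⟨aPoint_mem_Rpoly _ _, ?_⟩
      simp only [Set.mem_ofPred_eq, altSum_aPoint_even]
      linarith
    · rw [bPoint_eq n k l hn]
      exact hv _ _ (by omega)
    · rw [cPoint_eq n k l hn]
      exact hv _ _ (by omega)
  · rintro x ⟨hxR, hxa⟩
    simp only [Set.mem_ofPred_eq] at hxa
    obtain ⟨m, hm⟩ := hodd
    rcases Nat.eq_zero_or_pos m with hm0 | hm0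
    · subst hm0
      subst hm
      apply subset_convexHull
      exact Or.inl ⟨0, by omega, funext fun i => by have := i.2; omega⟩
    let A : Set (Fin (n - 1) → ℝ) := {x | ∃ k : ℕ, 2 * k ≤ n - 1 ∧ x = aPoint n (2 * k)}
    let B : Set (Fin (n - 1) → ℝ) := {x | ∃ k : ℕ, 2 * k + 2 < n ∧ x = aPoint n (2 * k + 1)}
    have hAB : {x | ∃ j < n, x = aPoint n j} ⊆ A ∪ B := by
      rintro _ ⟨j, hj, rfl⟩
      obtain ⟨k, hk | hk⟩ := Nat.even_or_odd' j
      · exact Or.inl ⟨k, by omega, by rw [hk]⟩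
      · exact Or.inr ⟨k, by omega, by rw [hk]⟩
    have hx := convexHull_mono hAB (Rpoly_subset n hn hxR)
    have hA : A.Nonempty := ⟨aPoint n (2 * 0), 0, by omega, rfl⟩
    have hB : B.Nonempty := ⟨aPoint n (2 * 0 + 1), 0, by omega, rfl⟩
    rw [convexHull_union hA hB, mem_convexJoin] at hx
    obtain ⟨p, hp, q, hq, u, v, hu, hv, huv, rfl⟩ := hx
    have hlin : ∀ c : ℝ, Convex ℝ {x | altSum n x = c} := by
      intro c x hx y hy a b ha hb hab
      simp only [Set.mem_ofPred_eq] at hx hy ⊢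
      rw [altSum_comb, hx, hy, ← add_mul, hab, one_mul]
    have hp0 : altSum n p = 0 := by
      refine convexHull_min (s := A) ?_ (hlin 0) hp
      rintro _ ⟨k, _, rfl⟩
      exact altSum_aPoint_even n k
    have hq0 : altSum n q = n := by
      refine convexHull_min (s := B) ?_ (hlin n) hq
      rintro _ ⟨k, hk, rfl⟩
      exact altSum_aPoint_odd n k hk
    rw [altSum_comb, hp0, hq0] at hxa
    have hn2 : (0 : ℝ) < (n : ℝ) - 1 := by
      have : (1 : ℝ) < n := by exact_mod_cast (by omega : 1 < n)
      linarith
    have hr := comb_mem A B _ (convex_convexHull ℝ {x : Fin (n - 1) → ℝ |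
        (∃ k : ℕ, 2 * k ≤ n - 1 ∧ x = aPoint n (2 * k)) ∨
        (∃ k l : ℕ, 2 * k + 2 * l + 3 ≤ n ∧ x = bPoint n k l) ∨
        (∃ k l : ℕ, 2 * k + 2 * l + 3 ≤ n ∧ x = cPoint n k l)})
        (1 / (n : ℝ)) (((n : ℝ) - 1) / n) (by
      rintro _ ⟨e, he, rfl⟩ _ ⟨o, ho, rfl⟩
      apply subset_convexHull
      rcases Nat.lt_or_ge o e with h | h
      · refine Or.inr (Or.inr ⟨o, e - o - 1, by omega, ?_⟩)
        rw [cPoint_eq n _ _ hn, show o + (e - o - 1) + 1 = e by omega]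
      · refine Or.inr (Or.inl ⟨e, o - e, by omega, ?_⟩)
        rw [bPoint_eq n _ _ hn, show e + (o - e) = o by omega]) p hp q hq
    have hp' := convexHull_mono (t := {x : Fin (n - 1) → ℝ |
        (∃ k : ℕ, 2 * k ≤ n - 1 ∧ x = aPoint n (2 * k)) ∨
        (∃ k l : ℕ, 2 * k + 2 * l + 3 ≤ n ∧ x = bPoint n k l) ∨
        (∃ k l : ℕ, 2 * k + 2 * l + 3 ≤ n ∧ x = cPoint n k l)}) (fun y hy => Or.inl hy) hp
    have hw : v * n / (n - 1) ≤ 1 := by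
      rw [div_le_one hn2]
      linarith
    have hfin := convex_convexHull ℝ _ hp' hr (sub_nonneg.2 hw)
      (div_nonneg (mul_nonneg hv hpos.le) hn2.le) (by ring)
    convert hfin using 1
    have hu' : u = 1 - v := by linarith
    ext i
    simp only [Pi.add_apply, Pi.smul_apply, smul_eq_mul, hu']
    have := hn2.ne'
    field_simp
    ring
end
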